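/- arXiv:2309.14644 — 4 statements merged into one kernel-verified Lean document; each statement's English description precedes it below -/
import Mathlib

section
/- Let p be a sock sequence that is not sorted. Then the leftmost sock of p that is not clumped in p becomes clumped in φ_{aba}(p), and every sock clumped in p remains clumped in φ_{aba}(p). Consequently, the number of distinct socks of p that are clumped in φ_{aba}(p) is strictly greater than the number of distinct socks of p that are clumped in p. -/
attribute [local instance] Classical.propDecidable

/-- Two lists have the same shape: same length and identical equality pattern
of entries (`q_i = q_j` iff `r_i = r_j`). -/
def SameShape {A : Type*} {B : Type*} (q : List A) (r : List B) : Prop :=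
  q.length = r.length ∧ ∀ i j : ℕ, (q[i]? = q[j]? ↔ r[i]? = r[j]?)

/-- `ContainsPat p σ` : the sock sequence `p` contains the pattern `σ`
(not necessarily consecutively): there are indices `i_1 < ⋯ < i_m` such that
`p_{i_j} = p_{i_k} ↔ σ_j = σ_k`. -/
def ContainsPat {A : Type*} {B : Type*} (p : List A) (σ : List B) : Prop :=
  ∃ q : List A, q.Sublist p ∧ SameShape q σ

/-- A sock sequence is sorted if all occurrences of each sock appear
consecutively. -/
def SortedSocks {A : Type*} (p : List A) : Prop :=
  ∀ i j k : ℕ, i ≤ j → j ≤ k → p[i]? = p[k]? → p[j]? = p[i]?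

/-- One pass of the deterministic σ-avoiding stack-sorting procedure:
`sortAux σ input stack` runs the σ-avoiding stack with the given remaining
input and current stack (stack listed from top to bottom), returning the rest
of the output.  If input remains and pushing the next input sock onto the
stack does not create a σ-pattern in the stack, that sock is pushed; otherwise
the top sock of the stack is popped to the output. -/
noncomputable def sortAux {A : Type*} {B : Type*} (σ : List B) : List A → List A → List A
  | [], stack => stack
  | x :: input, stack =>
    if ContainsPat (x :: stack) σ then
      match stack with
      | [] => sortAux σ input [x]
      | t :: rest => t :: sortAux σ (x :: input) rest
    else
      sortAux σ input (x :: stack)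
termination_by input stack => 2 * input.length + stack.length
decreasing_by all_goals simp only [List.length_cons]; omega

/-- The deterministic σ-avoiding stack-sorting map `φ_σ`. -/
noncomputable def phi {A : Type*} {B : Type*} (σ : List B) (p : List A) : List A :=
  sortAux σ p []

/-- The pattern `aba`: first and third socks equal, distinct from the second. -/
def abaPat : List ℕ := [0, 1, 0]

/-- A sock `x` is clumped in a sock sequence `p` if all occurrences of `x` in
`p` are consecutive. -/
def Clumped {A : Type*} (x : A) (p : List A) : Prop :=
  ∀ i j k : ℕ, i ≤ j → j ≤ k → p[i]? = some x → p[k]? = some x → p[j]? = some x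

theorem cons_sublist_drop {A : Type*} {l s : List A} {a : A} {m i : ℕ} (hm : m ≤ i)
    (ha : l[i]? = some a) (hs : s.Sublist (l.drop (i + 1))) :
    (a :: s).Sublist (l.drop m) := by
  obtain ⟨hi, rfl⟩ := List.getElem?_eq_some_iff.mp ha
  have h : (l[i] :: s).Sublist (l.drop i) := by
    rw [List.drop_eq_getElem_cons hi]
    exact hs.cons_cons _
  exact h.trans (List.drop_sublist_drop_left l hm)

theorem clumped_iff {A : Type*} {x : A} {l : List A} :
    Clumped x l ↔ ∀ b, b ≠ x → ¬ [x, b, x].Sublist l := by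
  constructor
  · intro h b hb hs
    obtain ⟨f, hf⟩ := List.sublist_iff_exists_orderEmbedding_getElem?_eq.mp hs
    have h0 := hf 0
    have h1 := hf 1
    have h2 := hf 2
    have := h (f 0) (f 1) (f 2) (f.monotone (by norm_num)) (f.monotone (by norm_num))
      (by simpa using h0.symm) (by simpa using h2.symm)
    rw [← h1] at this
    exact hb (by simpa using this)
  · intro h i j k hij hjk hi hk
    by_contra hj
    have hlt : j < l.length := by
      have := (List.getElem?_eq_some_iff.mp hk).1
      omega
    have hb : l[j]? = some l[j] := List.getElem?_eq_getElem hlt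
    have hij' : i ≠ j := by rintro rfl; exact hj hi
    have hjk' : j ≠ k := by rintro rfl; exact hj hk
    refine h l[j] (fun e => hj (by rw [hb, e])) ?_
    have h3 : [x].Sublist (l.drop (j + 1)) :=
      cons_sublist_drop (by omega) hk (List.nil_sublist _)
    have h2 : [l[j], x].Sublist (l.drop (i + 1)) := cons_sublist_drop (by omega) hb h3
    simpa using cons_sublist_drop (Nat.zero_le i) hi h2

theorem containsPat_abaPat_iff {A : Type*} {l : List A} :
    ContainsPat l abaPat ↔ ∃ x, ¬ Clumped x l := by
  simp only [clumped_iff, not_forall, not_not]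
  constructor
  · rintro ⟨q, hq, hlen, hs⟩
    match q, hlen with
    | [a, b, c], _ =>
      have h02 := hs 0 2
      have h01 := hs 0 1
      simp [abaPat] at h02 h01
      subst h02
      exact ⟨a, b, fun e => h01 e.symm, hq⟩
  · rintro ⟨x, b, hb, hs⟩
    refine ⟨_, hs, rfl, fun i j => ?_⟩
    rcases i with _ | _ | _ | i <;> rcases j with _ | _ | _ | j <;>
      simp [abaPat, hb, hb.symm]

theorem Clumped.sublist {A : Type*} {x : A} {l l' : List A} (h : Clumped x l)
    (hl : l'.Sublist l) : Clumped x l' :=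
  clumped_iff.mpr fun b hb hs => clumped_iff.mp h b hb (hs.trans hl)

theorem clumped_reverse {A : Type*} {x : A} {l : List A} :
    Clumped x l.reverse ↔ Clumped x l := by
  simp only [clumped_iff]
  refine forall₂_congr fun b _ => not_congr ?_
  rw [← List.reverse_sublist]
  simp

theorem clumped_of_notMem {A : Type*} {x : A} {l : List A} (h : x ∉ l) : Clumped x l :=
  clumped_iff.mpr fun _ _ hs => h (hs.subset (by simp))

theorem clumped_cons_of_ne {A : Type*} {x t : A} {l : List A} (ht : t ≠ x)
    (h : Clumped x l) : Clumped x (t :: l) := by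
  refine clumped_iff.mpr fun b hb hs => ?_
  rcases List.sublist_cons_iff.mp hs with h' | ⟨r, hr, _⟩
  · exact clumped_iff.mp h b hb h'
  · exact ht (List.cons.inj hr).1.symm

theorem clumped_cons_self_of_notMem {A : Type*} {x : A} {l : List A} (h : x ∉ l) :
    Clumped x (x :: l) := by
  refine clumped_iff.mpr fun b hb hs => ?_
  exact h ((List.cons_sublist_cons.mp hs).subset (by simp))

theorem clumped_cons_cons_self {A : Type*} {x : A} {l : List A}
    (h : Clumped x (x :: l)) : Clumped x (x :: x :: l) := by
  refine clumped_iff.mpr fun b hb hs => ?_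
  have h' := List.cons_sublist_cons.mp hs
  rcases List.sublist_cons_iff.mp h' with h' | ⟨r, hr, _⟩
  · exact clumped_iff.mp h b hb (h'.cons_cons x)
  · exact hb (List.cons.inj hr).1

theorem containsPat_abaPat_of_mem {A : Type*} {z t : A} {s : List A} (hz : z ∈ s)
    (hne : t ≠ z) : ContainsPat (z :: t :: s) abaPat :=
  containsPat_abaPat_iff.mpr ⟨z, fun h => clumped_iff.mp h t hne
    (((List.singleton_sublist.mpr hz).cons_cons t).cons_cons z)⟩

theorem mem_and_ne_of_containsPat {A : Type*} {z t : A} {s : List A}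
    (hs : ∀ x, Clumped x (t :: s)) (h : ContainsPat (z :: t :: s) abaPat) :
    z ∈ s ∧ t ≠ z := by
  obtain ⟨x, hx⟩ := containsPat_abaPat_iff.mp h
  have hzx : z = x := by
    by_contra hne
    exact hx (clumped_cons_of_ne hne (hs x))
  subst hzx
  have htz : t ≠ z := by
    rintro rfl
    exact hx (clumped_cons_cons_self (hs t))
  refine ⟨?_, htz⟩
  by_contra hz
  exact hx (clumped_cons_self_of_notMem (by simp [hz, htz.symm]))

theorem not_containsPat_singleton {A : Type*} (x : A) : ¬ ContainsPat [x] abaPat := by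
  rw [containsPat_abaPat_iff]
  rintro ⟨y, hy⟩
  refine hy (clumped_iff.mpr fun b _ hs => ?_)
  simpa using hs.length_le

section sortAux

variable {A : Type*} {x : A} {input stack : List A}

theorem sortAux_nil : sortAux abaPat [] stack = stack := by
  rw [sortAux]

theorem sortAux_push (h : ¬ ContainsPat (x :: stack) abaPat) :
    sortAux abaPat (x :: input) stack = sortAux abaPat input (x :: stack) := by
  rw [sortAux.eq_def]
  exact if_neg h

theorem sortAux_pop {t : A} (h : ContainsPat (x :: t :: stack) abaPat) :
    sortAux abaPat (x :: input) (t :: stack) = t :: sortAux abaPat (x :: input) stack := by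
  rw [sortAux, if_pos h]

/-- Induction along a run of the `aba`-avoiding stack: the stack always avoids `aba`, and a
sock is popped exactly when the next input sock occurs strictly below it, and differs from it. -/
theorem sortAux_induction {motive : List A → List A → Prop}
    (done : ∀ stack, (∀ a, Clumped a stack) → motive [] stack)
    (push : ∀ x input stack, (∀ a, Clumped a (x :: stack)) →
      motive input (x :: stack) → motive (x :: input) stack)
    (pop : ∀ x input t stack, (∀ a, Clumped a (t :: stack)) → x ∈ stack → t ≠ x →
      motive (x :: input) stack → motive (x :: input) (t :: stack))
    (input stack : List A) (hs : ∀ a, Clumped a stack) : motive input stack := by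
  match input, stack with
  | [], stack => exact done stack hs
  | x :: input, stack =>
    by_cases h : ContainsPat (x :: stack) abaPat
    · match stack, h, hs with
      | [], h, _ => exact absurd h (not_containsPat_singleton x)
      | t :: stack, h, hs =>
        obtain ⟨hx, ht⟩ := mem_and_ne_of_containsPat hs h
        exact pop x input t stack hs hx ht (sortAux_induction done push pop _ _
          fun a => (hs a).sublist (List.sublist_cons_self _ _))
    · have hs' : ∀ a, Clumped a (x :: stack) := by
        simpa [containsPat_abaPat_iff] using h
      exact push x input stack hs' (sortAux_induction done push pop _ _ hs')
termination_by 2 * input.length + stack.length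
decreasing_by all_goals simp only [List.length_cons]; omega

theorem sortAux_push_of_clumped (h : ∀ a, Clumped a (x :: stack)) :
    sortAux abaPat (x :: input) stack = sortAux abaPat input (x :: stack) :=
  sortAux_push (by simpa [containsPat_abaPat_iff] using h)

theorem sortAux_perm (hs : ∀ a, Clumped a stack) :
    (sortAux abaPat input stack).Perm (input ++ stack) := by
  refine sortAux_induction (motive := fun i s => (sortAux abaPat i s).Perm (i ++ s))
    ?_ ?_ ?_ input stack hs
  · intro s _
    simp [sortAux_nil]
  · intro x i s h ih
    rw [sortAux_push_of_clumped h]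
    exact ih.trans List.perm_middle
  · intro x i t s _ hx ht ih
    rw [sortAux_pop (containsPat_abaPat_of_mem hx ht)]
    exact (ih.cons t).trans List.perm_middle.symm

theorem clumped_sortAux (hs : ∀ a, Clumped a stack) (y : A)
    (hy : Clumped y (stack.reverse ++ input)) : Clumped y (sortAux abaPat input stack) := by
  refine sortAux_induction
    (motive := fun i s => Clumped y (s.reverse ++ i) → Clumped y (sortAux abaPat i s))
    ?_ ?_ ?_ input stack hs hy
  · intro s h _
    rw [sortAux_nil]
    exact h y
  · intro x i s h ih hc
    rw [sortAux_push_of_clumped h]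
    exact ih (by simpa using hc)
  · intro x i t s h hx ht ih hc
    rw [sortAux_pop (containsPat_abaPat_of_mem hx ht)]
    have hout : Clumped y (sortAux abaPat (x :: i) s) := by
      refine ih (hc.sublist ?_)
      simp
    by_cases hty : t = y
    · subst hty
      by_cases hmem : t ∈ s
      · match s, hmem, hx, h, hout with
        | r :: s, hmem, hx, h, hout =>
          have hr : r = t := by
            by_contra hr
            have hts : t ∈ s := by
              rcases List.mem_cons.mp hmem with e | e
              · exact absurd e.symm hr
              · exact e
            exact clumped_iff.mp (h t) r hr
              (((List.singleton_sublist.mpr hts).cons_cons r).cons_cons t)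
          subst hr
          have hxs : x ∈ s := by
            rcases List.mem_cons.mp hx with e | e
            · exact absurd e.symm ht
            · exact e
          rw [sortAux_pop (containsPat_abaPat_of_mem hxs ht)] at hout ⊢
          exact clumped_cons_cons_self hout
      · refine clumped_cons_self_of_notMem fun hm => ?_
        have hm' := (sortAux_perm fun a => (h a).sublist (List.sublist_cons_self _ _)).mem_iff.mp hm
        have hti : t ∈ i := by simpa [hmem, ht] using hm'
        refine clumped_iff.mp hc x ht.symm ?_
        have h1 : [t, x, t].Sublist (t :: x :: i) :=
          ((List.singleton_sublist.mpr hti).cons_cons x).cons_cons t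
        simpa using h1.trans (List.sublist_append_right s.reverse _)
    · exact clumped_cons_of_ne hty hout

theorem clumped_sortAux_of_bottom (y : A) (u v : List A)
    (hs : ∀ a, Clumped a (u ++ y :: v)) (hu : y ∉ u) (hv : ∀ a ∈ v, a ≠ y → a ∉ input) :
    Clumped y (sortAux abaPat input (u ++ y :: v)) := by
  refine sortAux_induction
    (motive := fun i s => ∀ u v, s = u ++ y :: v → y ∉ u → (∀ a ∈ v, a ≠ y → a ∉ i) →
      Clumped y (sortAux abaPat i s)) ?_ ?_ ?_ input _ hs u v rfl hu hv
  · intro s h _ _ _ _ _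
    rw [sortAux_nil]
    exact h y
  · rintro x i _ h ih u v rfl hu hv
    rw [sortAux_push_of_clumped h]
    by_cases hxy : x = y
    · subst hxy
      match u, hu, h, ih with
      | [], _, _, ih =>
        refine ih [] (x :: v) rfl (by simp) fun a ha hne => ?_
        have hav : a ∈ v := by simpa [hne] using ha
        exact fun hi => hv a hav hne (List.mem_cons_of_mem _ hi)
      | r :: u, hu, h, _ =>
        have hr : r ≠ x := fun e => hu (by simp [e])
        refine absurd ?_ (clumped_iff.mp (h x) r hr)
        exact ((List.singleton_sublist.mpr (by simp)).cons_cons r).cons_cons x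
    · exact ih (x :: u) v rfl (by simp [hu, Ne.symm hxy])
        fun a ha hne hi => hv a ha hne (List.mem_cons_of_mem _ hi)
  · intro x i t s h hx ht ih u v e hu hv
    rw [sortAux_pop (containsPat_abaPat_of_mem hx ht)]
    match u, hu, e with
    | [], _, e =>
      obtain ⟨rfl, rfl⟩ := List.cons.inj e
      exact absurd List.mem_cons_self (hv x hx ht.symm)
    | r :: u, hu, e =>
      obtain ⟨rfl, rfl⟩ := List.cons.inj e
      exact clumped_cons_of_ne (fun e => hu (by simp [e]))
        (ih u v rfl (fun hm => hu (List.mem_cons_of_mem _ hm)) hv)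

theorem sortAux_append (l : List A) (h : ∀ a, Clumped a (l.reverse ++ stack)) :
    sortAux abaPat (l ++ input) stack = sortAux abaPat input (l.reverse ++ stack) := by
  induction l generalizing stack with
  | nil => rfl
  | cons x l ih =>
    have h' : ∀ a, Clumped a (l.reverse ++ x :: stack) := by simpa using h
    rw [List.cons_append, sortAux_push_of_clumped, ih h']
    · simp
    · exact fun a => (h' a).sublist (List.sublist_append_right _ _)

end sortAux

theorem clumped_nil {A : Type*} (x : A) : Clumped x [] := clumped_of_notMem (by simp)

theorem clumped_phi {A : Type*} {x : A} {p : List A} (h : Clumped x p) :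
    Clumped x (phi abaPat p) :=
  clumped_sortAux clumped_nil x (by simpa using h)

theorem clumped_phi_of_clumped_prefix {A : Type*} {y : A} {l r : List A} (hy : y ∉ l)
    (hl : ∀ z ∈ l, Clumped z (l ++ y :: r)) : Clumped y (phi abaPat (l ++ y :: r)) := by
  have h : ∀ a, Clumped a (l.reverse ++ []) := by
    intro a
    rw [List.append_nil, clumped_reverse]
    by_cases ha : a ∈ l
    · exact (hl a ha).sublist (List.sublist_append_left _ _)
    · exact clumped_of_notMem ha
  have h' : ∀ a, Clumped a (y :: l.reverse) := by
    intro a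
    by_cases hay : y = a
    · subst hay
      exact clumped_cons_self_of_notMem (by simpa using hy)
    · exact clumped_cons_of_ne hay (by simpa using h a)
  rw [phi, sortAux_append l h, List.append_nil, sortAux_push_of_clumped h']
  refine clumped_sortAux_of_bottom y [] l.reverse h' (by simp) fun a ha hne hr => ?_
  have ha' : a ∈ l := by simpa using ha
  refine clumped_iff.mp (hl a ha') y hne.symm ?_
  exact (List.singleton_sublist.mpr ha').append ((List.singleton_sublist.mpr hr).cons_cons y)

theorem clumped_phi_of_leftmost {A : Type*} {p : List A} {i : ℕ} {y : A}
    (hi : p[i]? = some y) (hlt : ∀ (j : ℕ) (z : A), j < i → p[j]? = some z → Clumped z p)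
    (hy : ¬ Clumped y p) : Clumped y (phi abaPat p) := by
  obtain ⟨hip, rfl⟩ := List.getElem?_eq_some_iff.mp hi
  have hp : p.take i ++ p[i] :: p.drop (i + 1) = p := by
    rw [← List.drop_eq_getElem_cons hip, List.take_append_drop]
  have hl : ∀ z ∈ p.take i, Clumped z p := by
    intro z hz
    obtain ⟨j, hj, rfl⟩ := List.mem_iff_getElem.mp hz
    rw [List.length_take] at hj
    refine hlt j _ (by omega) ?_
    rw [List.getElem_take]
    exact List.getElem?_eq_getElem (by omega)
  have := clumped_phi_of_clumped_prefix (y := p[i]) (l := p.take i) (r := p.drop (i + 1))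
    (fun hm => hy (hl _ hm)) (by rwa [hp])
  rwa [hp] at this

theorem exists_leftmost_not_clumped {A : Type*} {p : List A} (hp : ¬ SortedSocks p) :
    ∃ (i : ℕ) (y : A), p[i]? = some y ∧ ¬ Clumped y p ∧
      ∀ (j : ℕ) (z : A), j < i → p[j]? = some z → Clumped z p := by
  have hex : ∃ (i : ℕ) (y : A), p[i]? = some y ∧ ¬ Clumped y p := by
    by_contra! hc
    refine hp fun i j k hij hjk hik => ?_
    cases hi : p[i]? with
    | none =>
      rw [List.getElem?_eq_none_iff] at hi ⊢
      omega
    | some x => exact hc i x hi i j k hij hjk hi (hik ▸ hi)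
  obtain ⟨y, hy, hyc⟩ := Nat.find_spec hex
  refine ⟨Nat.find hex, y, hy, hyc, fun j z hj hz => ?_⟩
  by_contra hzc
  exact Nat.find_min hex hj ⟨z, hz, hzc⟩

/-- If `p` is not sorted, then: every sock clumped in `p` stays clumped in
`φ_{aba}(p)`; the leftmost sock of `p` that is not clumped in `p` becomes
clumped in `φ_{aba}(p)`; consequently, strictly more distinct socks of `p` are
clumped in `φ_{aba}(p)` than are clumped in `p`. -/
theorem clumped_increases {A : Type*} (p : List A) (hp : ¬ SortedSocks p) :
    (∀ x : A, Clumped x p → Clumped x (phi abaPat p)) ∧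
    (∀ (i : ℕ) (y : A), p[i]? = some y →
      (∀ (j : ℕ) (z : A), j < i → p[j]? = some z → Clumped z p) →
      ¬ Clumped y p → Clumped y (phi abaPat p)) ∧
    Set.ncard {x : A | x ∈ p ∧ Clumped x p} <
      Set.ncard {x : A | x ∈ p ∧ Clumped x (phi abaPat p)} := by
  refine ⟨fun x hx => clumped_phi hx, fun i y hi hlt hy => clumped_phi_of_leftmost hi hlt hy, ?_⟩
  obtain ⟨i, y, hi, hy, hlt⟩ := exists_leftmost_not_clumped hp
  refine Set.ncard_lt_ncard ?_ (p.finite_toSet.subset fun x hx => hx.1)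
  refine ⟨fun x hx => ⟨hx.1, clumped_phi hx.2⟩, fun h => hy (h ⟨?_, ?_⟩).2⟩
  · exact List.mem_of_getElem? hi
  · exact clumped_phi_of_leftmost hi hlt hy
end

section
/- Let x be a sock, let m ≥ 1, let l_1, …, l_m > 0 and l_{m+1} ≥ 0 be integers, and let s_1, …, s_m be nonempty sock sequences none of which contains the sock x. Let p = x^{l_1} s_1 x^{l_2} s_2 ⋯ x^{l_m} s_m x^{l_{m+1}}. If φ_{aba}(p) is sorted, then (i) φ_{aba}(s_i) is sorted for every i ∈ {1, …, m}, and (ii) for every i ∈ {1, …, m−1}, the sets of distinct socks appearing in s_i and in s_{i+1} have at most one common element. -/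
attribute [local instance] Classical.propDecidable

section

variable {A B : Type*}

theorem sameShape_abaPat_iff (q : List A) :
    SameShape q abaPat ↔ ∃ a b, a ≠ b ∧ q = [a, b, a] := by
  constructor
  · rintro ⟨hlen, h⟩
    match q, hlen, h with
    | [a, b, c], _, h =>
      have h₁ := h 0 1
      have h₂ := h 0 2
      simp only [abaPat, List.getElem?_cons_zero, List.getElem?_cons_succ, Option.some.injEq,
        zero_ne_one, iff_false, iff_true] at h₁ h₂
      exact ⟨a, b, h₁, by rw [← h₂]⟩
  · rintro ⟨a, b, hab, rfl⟩
    refine ⟨rfl, ?_⟩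
    rintro (_ | _ | _ | i) (_ | _ | _ | j) <;> simp [abaPat, hab, hab.symm]

theorem containsPat_abaPat_iff_s14 (p : List A) :
    ContainsPat p abaPat ↔ ∃ a b, a ≠ b ∧ [a, b, a].Sublist p := by
  simp only [ContainsPat, sameShape_abaPat_iff]
  constructor
  · rintro ⟨q, hq, a, b, hab, rfl⟩
    exact ⟨a, b, hab, hq⟩
  · rintro ⟨a, b, hab, h⟩
    exact ⟨_, h, a, b, hab, rfl⟩

theorem SortedSocks.of_sublist {p q : List A} (hp : SortedSocks p) (h : q.Sublist p) :
    SortedSocks q := by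
  obtain ⟨f, hf⟩ := List.sublist_iff_exists_orderEmbedding_getElem?_eq.mp h
  intro i j k hij hjk hik
  rw [hf, hf] at hik ⊢
  exact hp _ _ _ (f.monotone hij) (f.monotone hjk) hik

theorem SortedSocks.not_sublist {p : List A} (hp : SortedSocks p) {a b : A} (hab : a ≠ b) :
    ¬ [a, b, a].Sublist p := fun h => by
  have := hp.of_sublist h 0 1 2 (by simp) (by simp) rfl
  simp only [List.getElem?_cons_zero, List.getElem?_cons_succ, Option.some.injEq] at this
  exact hab this.symm

theorem sortAux_push_s14 {σ : List B} {y : A} {input stack : List A}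
    (h : ¬ ContainsPat (y :: stack) σ) :
    sortAux σ (y :: input) stack = sortAux σ input (y :: stack) := by
  rw [sortAux.eq_def]
  exact if_neg h

theorem sortAux_pop_s14 {σ : List B} {y t : A} {input rest : List A}
    (h : ContainsPat (y :: t :: rest) σ) :
    sortAux σ (y :: input) (t :: rest) = t :: sortAux σ (y :: input) rest := by
  rw [sortAux.eq_def]
  exact if_pos h

theorem mem_sortAux (σ : List B) (input stack : List A) (a : A) :
    a ∈ sortAux σ input stack ↔ a ∈ input ∨ a ∈ stack := by
  induction input, stack using sortAux.induct σ with
  | case1 stack => simp [sortAux]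
  | case2 y input h ih => rw [sortAux]; simp [h, ih, or_comm]
  | case3 y input t rest h ih => rw [sortAux_pop_s14 h]; simp [ih]; tauto
  | case4 y input stack h ih => rw [sortAux_push_s14 h]; simp [ih]; tauto

theorem mem_phi (σ : List B) (p : List A) (a : A) : a ∈ phi σ p ↔ a ∈ p := by
  simp [phi, mem_sortAux]

theorem containsPat_abaPat_append_replicate {x : A} {p : List A} (hx : x ∉ p) (k : ℕ) :
    ContainsPat (p ++ List.replicate k x) abaPat ↔ ContainsPat p abaPat := by
  simp only [containsPat_abaPat_iff_s14]
  constructor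
  · rintro ⟨a, b, hab, h⟩
    refine ⟨a, b, hab, ?_⟩
    obtain ⟨u, v, huv, hu, hv⟩ := List.sublist_append_iff.mp h
    obtain ⟨n, -, rfl⟩ := List.sublist_replicate_iff.mp hv
    rcases n with _ | n
    · simpa [huv] using hu
    · have hu' : x ∉ u := fun h => hx (hu.subset h)
      exfalso
      clear h hu hv
      rcases u with _ | ⟨c, _ | ⟨d, _ | ⟨e, u⟩⟩⟩ <;> rcases n with _ | _ | n <;>
        simp [List.replicate_succ] at huv hu' <;> grind
  · rintro ⟨a, b, hab, h⟩
    exact ⟨a, b, hab, h.trans (List.sublist_append_left _ _)⟩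

theorem not_containsPat_abaPat_replicate (x : A) (k : ℕ) :
    ¬ ContainsPat (List.replicate k x) abaPat := by
  rw [containsPat_abaPat_iff_s14]
  rintro ⟨a, b, hab, h⟩
  have ha := List.eq_of_mem_replicate (h.subset (by simp : a ∈ [a, b, a]))
  have hb := List.eq_of_mem_replicate (h.subset (by simp : b ∈ [a, b, a]))
  exact hab (ha.trans hb.symm)

theorem sortAux_abaPat_append {x : A} (k : ℕ) (rest : List A)
    (hrest : ∀ y ∈ rest.head?, y = x) (input stack : List A)
    (hinput : x ∉ input) (hstack : x ∉ stack) :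
    sortAux abaPat (input ++ rest) (stack ++ List.replicate (k + 1) x) =
      sortAux abaPat input stack ++ sortAux abaPat rest (List.replicate (k + 1) x) := by
  induction input, stack using sortAux.induct abaPat with
  | case1 stack =>
    rw [sortAux.eq_1, List.nil_append]
    cases rest with
    | nil => simp [sortAux]
    | cons y rest =>
      obtain rfl : y = x := hrest y (by simp)
      induction stack with
      | nil => rfl
      | cons t st ih =>
        have h : ContainsPat (y :: t :: (st ++ List.replicate (k + 1) y)) abaPat := by
          rw [containsPat_abaPat_iff_s14]
          refine ⟨y, t, fun h => hstack (by simp [h]), ?_⟩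
          refine List.Sublist.cons_cons _ (List.Sublist.cons_cons _ ?_)
          simp
        rw [List.cons_append, sortAux_pop_s14 h, ih (fun h => hstack (by simp [h])), List.cons_append]
  | case2 y input h ih =>
    exact absurd h (not_containsPat_abaPat_replicate y 1)
  | case3 y input t st h ih =>
    have h' := (containsPat_abaPat_append_replicate (x := x) (p := y :: t :: st)
      (by simp_all) (k + 1)).mpr h
    simp only [List.cons_append] at h'
    rw [List.cons_append, List.cons_append, sortAux_pop_s14 h', sortAux_pop_s14 h]
    simp only [List.cons_append, List.cons.injEq, true_and] at ih ⊢
    exact ih hinput (by simp_all)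
  | case4 y input st h ih =>
    have h' := (containsPat_abaPat_append_replicate (x := x) (p := y :: st)
      (by simp_all) (k + 1)).not.mpr h
    rw [List.cons_append] at h'
    rw [List.cons_append, sortAux_push_s14 h', sortAux_push_s14 h]
    exact ih (by simp_all) (by simp_all)

theorem sortAux_abaPat_replicate_append (x : A) (l k : ℕ) (rest : List A) :
    sortAux abaPat (List.replicate l x ++ rest) (List.replicate k x) =
      sortAux abaPat rest (List.replicate (k + l) x) := by
  induction l generalizing k with
  | zero => rfl
  | succ l ih =>
    have h := not_containsPat_abaPat_replicate x (k + 1)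
    rw [List.replicate_succ] at h
    rw [List.replicate_succ, List.cons_append, sortAux_push_s14 h, ← List.replicate_succ, ih]
    congr 2
    omega

theorem sortAux_abaPat_blocks (x : A) (e : ℕ) (L : List (ℕ × List A))
    (hpos : ∀ b ∈ L, 0 < b.1) (hx : ∀ b ∈ L, x ∉ b.2) (k : ℕ) :
    ∃ N, sortAux abaPat ((L.map fun b => List.replicate b.1 x ++ b.2).flatten ++
        List.replicate e x) (List.replicate k x) =
      (L.map fun b => phi abaPat b.2).flatten ++ List.replicate N x := by
  induction L generalizing k with
  | nil =>
    refine ⟨k + e, ?_⟩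
    have h := sortAux_abaPat_replicate_append x e k []
    rw [sortAux, List.append_nil] at h
    simpa using h
  | cons b L ih =>
    obtain ⟨l, s⟩ := b
    obtain ⟨l, rfl⟩ : ∃ l', l = l' + 1 :=
      Nat.exists_eq_add_one.mpr (hpos (l, s) (by simp))
    obtain ⟨N, hN⟩ := ih (fun b hb => hpos b (by simp [hb])) (fun b hb => hx b (by simp [hb]))
      (k + l + 1)
    refine ⟨N, ?_⟩
    simp only [List.map_cons, List.flatten_cons, List.append_assoc]
    rw [sortAux_abaPat_replicate_append, ← hN, ← add_assoc, phi]
    refine sortAux_abaPat_append (k + l) _ ?_ s [] (hx (l + 1, s) (by simp)) (by simp)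
    cases L with
    | nil => cases e <;> simp [List.replicate_succ]
    | cons c L =>
      obtain ⟨n, hn⟩ := Nat.exists_eq_add_one.mpr (hpos c (by simp))
      simp [hn, List.replicate_succ]

theorem SortedSocks.eq_of_mem_of_mem {u v : List A} (h : SortedSocks (u ++ v)) {a b : A}
    (hau : a ∈ u) (hbu : b ∈ u) (hav : a ∈ v) (hbv : b ∈ v) : a = b := by
  by_contra hab
  obtain ⟨u₁, u₂, rfl⟩ := List.append_of_mem hau
  have hb : b ∈ u₁ ∨ b ∈ u₂ := by
    simpa [Ne.symm hab] using hbu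
  rcases hb with hb | hb
  · refine h.not_sublist (Ne.symm hab) ?_
    have h₁ : [b].Sublist u₁ := List.singleton_sublist.mpr hb
    have h₂ : [a].Sublist (a :: u₂) := by simp
    exact (h₁.append h₂).append (List.singleton_sublist.mpr hbv)
  · refine h.not_sublist hab ?_
    have h₁ : [a, b].Sublist (a :: u₂) := (List.singleton_sublist.mpr hb).cons_cons a
    exact (h₁.trans (List.sublist_append_right _ _)).append (List.singleton_sublist.mpr hav)

end

/-- If `p = x^{l_1} s_1 x^{l_2} s_2 ⋯ x^{l_m} s_m x^{l_{m+1}}` (with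
`l_1,…,l_m > 0`, `l_{m+1} ≥ 0`, the `s_i` nonempty and not containing `x`) is
`1`-stack-sortable under `φ_{aba}`, then each `s_i` is `1`-stack-sortable
under `φ_{aba}`, and consecutive `s_i`, `s_{i+1}` share at most one distinct
sock. -/
theorem one_sortable_decomposition {A : Type*} [DecidableEq A]
    (x : A) (m : ℕ) (hm : 1 ≤ m)
    (l : Fin (m + 1) → ℕ) (hl : ∀ i : Fin m, 0 < l i.castSucc)
    (s : Fin m → List A) (hs : ∀ i, s i ≠ []) (hsx : ∀ i, x ∉ s i)
    (hsorted : SortedSocks (phi abaPat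
      ((List.ofFn fun i : Fin m =>
          List.replicate (l i.castSucc) x ++ s i).flatten
        ++ List.replicate (l (Fin.last m)) x))) :
    (∀ i : Fin m, SortedSocks (phi abaPat (s i))) ∧
    (∀ (i : ℕ) (h : i + 1 < m),
      ((s ⟨i, by omega⟩).toFinset ∩ (s ⟨i + 1, h⟩).toFinset).card ≤ 1) := by
  obtain ⟨N, hN⟩ := sortAux_abaPat_blocks x (l (Fin.last m))
    (List.ofFn fun i : Fin m => (l i.castSucc, s i))
    (by simpa [List.forall_mem_ofFn_iff] using hl)
    (by simpa [List.forall_mem_ofFn_iff] using hsx) 0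
  simp only [List.map_ofFn, Function.comp_def, List.replicate_zero] at hN
  rw [phi, hN] at hsorted
  replace hsorted := hsorted.of_sublist (List.sublist_append_left _ _)
  refine ⟨fun i => hsorted.of_sublist (List.sublist_flatten_of_mem ?_), fun i hi => ?_⟩
  · exact List.mem_ofFn.mpr ⟨i, rfl⟩
  · have h : SortedSocks (phi abaPat (s ⟨i, by omega⟩) ++ phi abaPat (s ⟨i + 1, hi⟩)) := by
      set F := List.ofFn fun i : Fin m => phi abaPat (s i) with hF
      have hd : F.drop i = phi abaPat (s ⟨i, by omega⟩) :: phi abaPat (s ⟨i + 1, hi⟩) ::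
          F.drop (i + 2) := by
        rw [List.drop_eq_getElem_cons (by simp [hF]; omega),
          List.drop_eq_getElem_cons (by simp [hF]; omega)]
        simp [hF]
      rw [← List.take_append_drop i F, hd] at hsorted
      simp only [List.flatten_append, List.flatten_cons] at hsorted
      rw [← List.append_assoc (phi _ _)] at hsorted
      exact hsorted.of_sublist
        ((List.sublist_append_left _ _).trans (List.sublist_append_right _ _))
    rw [Finset.card_le_one]
    intro a ha b hb
    simp only [Finset.mem_inter, List.mem_toFinset] at ha hb
    exact h.eq_of_mem_of_mem ((mem_phi _ _ _).mpr ha.1) ((mem_phi _ _ _).mpr hb.1)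
      ((mem_phi _ _ _).mpr ha.2) ((mem_phi _ _ _).mpr hb.2)
end

section
/- Let m ≥ 2, let a_1, …, a_m be pairwise distinct socks, and let k_1, …, k_m be positive integers. Then the sock sequence p* = a_1^{k_1} a_2^{k_2} ⋯ a_m^{k_m} a_1 avoids each of the patterns abab, abac, and caba (where a, b, c denote pairwise distinct socks). Consequently, p* avoids every sock pattern σ containing abab, abac, or caba, and also avoids the reverse of every such σ. -/
attribute [local instance] Classical.propDecidable

theorem getElem?_reverse_ite {A : Type*} (l : List A) (i : ℕ) :
    l.reverse[i]? = l[if i < l.length then l.length - 1 - i else l.length]? := by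
  split_ifs with hi
  · exact List.getElem?_reverse hi
  · simp [not_lt.mp hi]

theorem SameShape.trans {A B C : Type*} {q : List A} {r : List B} {s : List C}
    (h₁ : SameShape q r) (h₂ : SameShape r s) : SameShape q s :=
  ⟨h₁.1.trans h₂.1, fun i j => (h₁.2 i j).trans (h₂.2 i j)⟩

theorem SameShape.reverse {A B : Type*} {q : List A} {r : List B} (h : SameShape q r) :
    SameShape q.reverse r.reverse := by
  obtain ⟨hl, h⟩ := h
  refine ⟨by simp [hl], fun i j => ?_⟩
  rw [getElem?_reverse_ite q, getElem?_reverse_ite q, getElem?_reverse_ite r,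
    getElem?_reverse_ite r, hl]
  exact h _ _

/-- A sublist of `r` can be transported to a sublist of the same shape of any list with the
shape of `r`. -/
theorem SameShape.exists_sublist {A B : Type*} {q : List A} {r t : List B}
    (h : SameShape q r) (ht : t.Sublist r) : ∃ s : List A, s.Sublist q ∧ SameShape s t := by
  obtain ⟨f, hf⟩ := List.sublist_iff_exists_orderEmbedding_getElem?_eq.mp ht
  have hlt (i : ℕ) : i < t.length ↔ f i < q.length := by
    rw [h.1, ← not_le, ← not_le, ← List.getElem?_eq_none_iff, ← List.getElem?_eq_none_iff, hf]
  let s := List.ofFn fun i : Fin t.length => q[f i]'((hlt i).mp i.2)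
  have hs (i : ℕ) : s[i]? = q[f i]? := by
    by_cases hi : i < t.length
    · simp [s, hi, (hlt i).mp hi]
    · rw [List.getElem?_eq_none (by simpa [s] using hi),
        List.getElem?_eq_none (not_lt.mp (mt (hlt i).mpr hi))]
  refine ⟨s, List.sublist_iff_exists_orderEmbedding_getElem?_eq.mpr ⟨f, hs⟩, by simp [s],
    fun i j => ?_⟩
  rw [hs, hs, hf, hf]
  exact h.2 _ _

theorem ContainsPat.trans {A B C : Type*} {p : List A} {σ : List B} {τ : List C}
    (h₁ : ContainsPat p σ) (h₂ : ContainsPat σ τ) : ContainsPat p τ := by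
  obtain ⟨q, hq, hqσ⟩ := h₁
  obtain ⟨t, ht, htτ⟩ := h₂
  obtain ⟨s, hs, hst⟩ := hqσ.exists_sublist ht
  exact ⟨s, hs.trans hq, hst.trans htτ⟩

theorem ContainsPat.reverse {A B : Type*} {p : List A} {σ : List B} (h : ContainsPat p σ) :
    ContainsPat p.reverse σ.reverse := by
  obtain ⟨q, hq, hqσ⟩ := h
  exact ⟨q.reverse, hq.reverse, hqσ.reverse⟩

theorem pairwise_le_flatten_ofFn_replicate {m : ℕ} (k : Fin m → ℕ) :
    (List.ofFn fun i : Fin m => List.replicate (k i) i).flatten.Pairwise (· ≤ ·) := by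
  rw [List.pairwise_flatten]
  refine ⟨fun l hl => ?_, List.pairwise_ofFn.mpr fun i j hij x hx y hy => ?_⟩
  · obtain ⟨i, rfl⟩ := List.mem_ofFn.mp hl
    simp [List.pairwise_replicate]
  · rw [List.eq_of_mem_replicate hx, List.eq_of_mem_replicate hy]
    exact hij.le

/-- A pattern of length four contained in `a_1^{k_1} ⋯ a_m^{k_m} a_1` starts neither with `aba`
nor, after a letter other than `a`, ends with `aba`. -/
theorem ContainsPat.four_letters {A B : Type*} {m : ℕ} (hm : 0 < m) {a : Fin m → A}
    (ha : Function.Injective a) {k : Fin m → ℕ} {w x y z : B}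
    (h : ContainsPat ((List.ofFn fun i : Fin m => List.replicate (k i) (a i)).flatten
      ++ [a ⟨0, hm⟩]) [w, x, y, z]) :
    (w = y → w = x) ∧ (x = z → x = y ∨ w = x) := by
  obtain ⟨q, hq, hlen, hshape⟩ := h
  have hmap : (List.ofFn fun i : Fin m => List.replicate (k i) (a i)).flatten ++ [a ⟨0, hm⟩] =
      ((List.ofFn fun i : Fin m => List.replicate (k i) i).flatten ++ [(⟨0, hm⟩ : Fin m)]).map a := by
    simp [List.map_flatten, List.map_ofFn, Function.comp_def]
  rw [hmap, List.sublist_map_iff] at hq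
  obtain ⟨r, hr, rfl⟩ := hq
  rw [List.length_map] at hlen
  obtain ⟨r₁, r₂, rfl, hr₁, hr₂⟩ := List.sublist_append_iff.mp hr
  have hsorted := (pairwise_le_flatten_ofFn_replicate k).sublist hr₁
  have hwx := hshape 0 1
  have hwy := hshape 0 2
  have hxy := hshape 1 2
  have hxz := hshape 1 3
  rcases List.sublist_singleton.mp hr₂ with rfl | rfl
  · obtain ⟨i, j, l, n, rfl⟩ := List.length_eq_four.mp (by simpa using hlen)
    simp [ha.eq_iff] at hsorted hwx hwy hxy hxz
    grind
  · obtain ⟨i, j, l, rfl⟩ := List.length_eq_three.mp (by simpa using hlen)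
    simp [ha.eq_iff] at hsorted hwx hwy hxy hxz
    have hmin : (⟨0, hm⟩ : Fin m) ≤ i := Nat.zero_le _
    grind

/-- For `m ≥ 2`, pairwise distinct socks `a_1, …, a_m`, and positive integers
`k_1, …, k_m`, the sock sequence `p* = a_1^{k_1} a_2^{k_2} ⋯ a_m^{k_m} a_1`
avoids the patterns `abab`, `abac`, and `caba`; consequently `p*` avoids
every pattern `σ` containing one of these, as well as the reverse of every
such `σ`. -/
theorem appended_sorted_avoids {A : Type*} (m : ℕ) (hm : 2 ≤ m)
    (a : Fin m → A) (ha : Function.Injective a)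
    (k : Fin m → ℕ) (hk : ∀ i, 0 < k i) :
    ¬ ContainsPat
        ((List.ofFn fun i : Fin m => List.replicate (k i) (a i)).flatten
          ++ [a ⟨0, by omega⟩])
        ([0, 1, 0, 1] : List ℕ) ∧
    ¬ ContainsPat
        ((List.ofFn fun i : Fin m => List.replicate (k i) (a i)).flatten
          ++ [a ⟨0, by omega⟩])
        ([0, 1, 0, 2] : List ℕ) ∧
    ¬ ContainsPat
        ((List.ofFn fun i : Fin m => List.replicate (k i) (a i)).flatten
          ++ [a ⟨0, by omega⟩])
        ([2, 0, 1, 0] : List ℕ) ∧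
    ∀ {B : Type*} (σ : List B),
      (ContainsPat σ ([0, 1, 0, 1] : List ℕ) ∨
        ContainsPat σ ([0, 1, 0, 2] : List ℕ) ∨
        ContainsPat σ ([2, 0, 1, 0] : List ℕ)) →
      ¬ ContainsPat
          ((List.ofFn fun i : Fin m => List.replicate (k i) (a i)).flatten
            ++ [a ⟨0, by omega⟩]) σ ∧
      ¬ ContainsPat
          ((List.ofFn fun i : Fin m => List.replicate (k i) (a i)).flatten
            ++ [a ⟨0, by omega⟩]) σ.reverse := by
  refine ⟨fun h => ?_, fun h => ?_, fun h => ?_, fun {B} σ hσ => ⟨fun h => ?_, fun h => ?_⟩⟩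
  · simpa using (h.four_letters (by omega) ha).1
  · simpa using (h.four_letters (by omega) ha).1
  · simpa using (h.four_letters (by omega) ha).2
  · rcases hσ with hσ | hσ | hσ
    · simpa using ((h.trans hσ).four_letters (by omega) ha).1
    · simpa using ((h.trans hσ).four_letters (by omega) ha).1
    · simpa using ((h.trans hσ).four_letters (by omega) ha).2
  · rcases hσ with hσ | hσ | hσ
    · simpa using ((h.trans hσ.reverse).four_letters (by omega) ha).1
    · simpa using ((h.trans hσ.reverse).four_letters (by omega) ha).2
    · simpa using ((h.trans hσ.reverse).four_letters (by omega) ha).1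
end

section
/- Let m ≥ 2, let a_1, …, a_m be pairwise distinct socks, and let k_1, …, k_m be positive integers with k_1 ≥ 2. Then the sock sequence p* = a_1^{k_1 − 1} a_2 a_1 a_2^{k_2 − 1} a_3^{k_3} ⋯ a_m^{k_m} (obtained from the sorted sequence a_1^{k_1} a_2^{k_2} ⋯ a_m^{k_m} by swapping the last a_1 with the first a_2) avoids both of the patterns abba and abca (where a, b, c denote pairwise distinct socks). Consequently, p* avoids every sock pattern σ containing abba or abca, and also avoids the reverse of every such σ. -/
attribute [local instance] Classical.propDecidable

/-- No entry of `p` recurs with two intermediate entries both different from it; this amounts to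
avoiding both of the patterns `abba` and `abca`. -/
def NoWideReturn {A : Type*} (p : List A) : Prop :=
  ∀ x y z : A, y ≠ x → z ≠ x → ¬ [x, y, z, x].Sublist p

theorem SameShape.fst_eq_iff_of_mem_zip {A : Type*} {B : Type*} {q : List A} {r : List B}
    (h : SameShape q r) {u v : A × B} (hu : u ∈ q.zip r) (hv : v ∈ q.zip r) :
    u.1 = v.1 ↔ u.2 = v.2 := by
  obtain ⟨i, hi⟩ := List.mem_iff_getElem?.1 hu
  obtain ⟨j, hj⟩ := List.mem_iff_getElem?.1 hv
  rw [List.getElem?_zip_eq_some] at hi hj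
  simpa [hi.1, hi.2, hj.1, hj.2] using h.2 i j

namespace NoWideReturn

variable {A : Type*} {B : Type*}

theorem of_containsPat {p : List A} {σ : List B} (hp : NoWideReturn p) (h : ContainsPat p σ) :
    NoWideReturn σ := by
  intro x y z hy hz hs
  obtain ⟨q, hq, hqσ⟩ := h
  rw [← List.map_snd_zip hqσ.1.ge, List.sublist_map_iff] at hs
  obtain ⟨w, hw, hwx⟩ := hs
  obtain ⟨w₁, w₂, w₃, w₄, rfl⟩ : ∃ w₁ w₂ w₃ w₄, w = [w₁, w₂, w₃, w₄] := by
    rw [← List.length_eq_four]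
    simpa using (congrArg List.length hwx).symm
  simp only [List.map_cons, List.map_nil, List.cons.injEq, and_true] at hwx
  obtain ⟨rfl, rfl, rfl, h₄⟩ := hwx
  have hmem := hw.subset
  have h₁ : w₁ ∈ q.zip σ := hmem (by simp)
  have h₁₄ := (hqσ.fst_eq_iff_of_mem_zip h₁ (hmem (by simp : w₄ ∈ _))).2 h₄
  refine hp w₁.1 w₂.1 w₃.1
    (mt (hqσ.fst_eq_iff_of_mem_zip (hmem (by simp)) h₁).1 hy)
    (mt (hqσ.fst_eq_iff_of_mem_zip (hmem (by simp)) h₁).1 hz) ?_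
  have hfst := hw.map Prod.fst
  rw [List.map_fst_zip hqσ.1.le] at hfst
  simpa [← h₁₄] using hfst.trans hq

theorem of_reverse {p : List A} (h : NoWideReturn p.reverse) : NoWideReturn p :=
  fun x y z hy hz hs => h x z y hz hy (by simpa using hs.reverse)

theorem not_containsPat_of_sublist {p : List A} (hp : NoWideReturn p) {σ : List B} {x y z : B}
    (hy : y ≠ x) (hz : z ≠ x) (h : [x, y, z, x].Sublist σ) : ¬ ContainsPat p σ :=
  fun hc => hp.of_containsPat hc x y z hy hz h

theorem nil : NoWideReturn ([] : List A) := by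
  intro x y z _ _ h
  simp at h

theorem replicate (n : ℕ) (a : A) : NoWideReturn (List.replicate n a) := by
  intro x y z hy _ h
  have hx := List.eq_of_mem_replicate (h.subset (by simp : x ∈ _))
  have hy' := List.eq_of_mem_replicate (h.subset (by simp : y ∈ _))
  exact hy (hy'.trans hx.symm)

theorem append {p q : List A} (hp : NoWideReturn p) (hq : NoWideReturn q) (hpq : p.Disjoint q) :
    NoWideReturn (p ++ q) := by
  intro x y z hy hz h
  obtain ⟨u, v, huv, hu, hv⟩ := List.sublist_append_iff.1 h
  rcases u with _ | ⟨c, u⟩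
  · exact hq x y z hy hz (by simpa [huv] using hv)
  rcases List.eq_nil_or_concat' v with rfl | ⟨v, d, rfl⟩
  · exact hp x y z hy hz (by simpa [huv] using hu)
  have hc : x = c := by simpa using congrArg List.head? huv
  have hd : x = d := by
    rw [← List.append_assoc] at huv
    simpa only [List.getLast?_concat, List.getLast?_cons_cons, List.getLast?_singleton,
      Option.some.injEq] using congrArg List.getLast? huv
  exact hpq (hu.subset (by simp [hc] : x ∈ _)) (hv.subset (by simp [hd]))

theorem flatten {L : List (List A)} (hL : ∀ l ∈ L, NoWideReturn l)
    (hd : L.Pairwise List.Disjoint) : NoWideReturn L.flatten := by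
  induction L with
  | nil => exact nil
  | cons l L ih =>
    rw [List.pairwise_cons] at hd
    rw [List.forall_mem_cons] at hL
    refine hL.1.append (ih hL.2 hd.2) ?_
    intro c hc hc'
    obtain ⟨l', hl', hcl'⟩ := List.mem_flatten.1 hc'
    exact hd.1 l' hl' hc hcl'

theorem swapped_blocks {a b : A} (hab : a ≠ b) (n l : ℕ) :
    NoWideReturn (List.replicate n a ++ [b] ++ [a] ++ List.replicate l b) := by
  have hbba : ¬ [b, b, a].Sublist (List.replicate n a ++ [b] ++ [a] ++ List.replicate l b) := by
    induction n with
    | zero =>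
      intro h
      simp [List.cons_sublist_cons', hab.symm] at h
      exact hab (List.eq_of_mem_replicate (h.subset (by simp)))
    | succ n ih => simpa [List.replicate_succ, List.cons_sublist_cons', hab.symm] using ih
  have hbaa : ¬ [b, a, a].Sublist (List.replicate n a ++ [b] ++ [a] ++ List.replicate l b) := by
    clear hbba
    induction n with
    | zero =>
      intro h
      have := h.count_le a
      simp [List.count_replicate, hab.symm] at this
    | succ n ih =>
      intro h
      rw [List.replicate_succ] at h
      simp only [List.cons_append, List.cons_sublist_cons', hab.symm, false_and, or_false] at h
      exact ih h
  intro x y z hy hz h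
  have hmem : ∀ c ∈ [x, y, z, x], c = a ∨ c = b := by
    intro c hc
    have := h.subset hc
    simp only [List.mem_append, List.mem_replicate, List.mem_singleton] at this
    tauto
  have hx := hmem x (by simp)
  have hy' := hmem y (by simp)
  have hz' := hmem z (by simp)
  rcases hx with rfl | rfl
  · obtain rfl := hy'.resolve_left hy
    obtain rfl := hz'.resolve_left hz
    exact hbba ((List.sublist_cons_self _ _).trans h)
  · obtain rfl := hy'.resolve_right hy
    obtain rfl := hz'.resolve_right hz
    exact hbaa (List.Sublist.trans (List.sublist_append_left [_, _, _] [_]) h)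

theorem swapped_sorted {m : ℕ} {a : Fin m → A} (ha : Function.Injective a) (k : Fin m → ℕ)
    {i₀ i₁ : Fin m} (h₀ : i₀.val = 0) (h₁ : i₁.val = 1) (n l : ℕ) :
    NoWideReturn (List.replicate n (a i₀) ++ [a i₁] ++ [a i₀] ++ List.replicate l (a i₁)
      ++ ((List.ofFn fun i : Fin m => List.replicate (k i) (a i)).drop 2).flatten) := by
  refine (swapped_blocks (ha.ne (by simp [Fin.ext_iff, h₀, h₁])) n l).append (flatten ?_ ?_) ?_
  · intro q hq
    obtain ⟨i, rfl⟩ := (List.mem_ofFn' _ _).1 (List.mem_of_mem_drop hq)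
    exact replicate _ _
  · refine List.Pairwise.sublist (List.drop_sublist _ _)
      (List.pairwise_ofFn.2 fun i j hij c hi hj => ?_)
    exact hij.ne (ha ((List.eq_of_mem_replicate hi).symm.trans (List.eq_of_mem_replicate hj)))
  · intro c hc hc'
    obtain ⟨q, hq, hcq⟩ := List.mem_flatten.1 hc'
    obtain ⟨i, hi, rfl⟩ := List.mem_drop_iff_getElem.1 hq
    simp only [List.getElem_ofFn, List.mem_replicate] at hcq
    simp only [List.mem_append, List.mem_replicate, List.mem_singleton, hcq.2, ha.eq_iff,
      Fin.ext_iff] at hc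
    omega

end NoWideReturn

/-- For `m ≥ 2`, pairwise distinct socks `a_1, …, a_m`, and positive integers
`k_1, …, k_m` with `k_1 ≥ 2`, the sock sequence
`p* = a_1^{k_1-1} a_2 a_1 a_2^{k_2-1} a_3^{k_3} ⋯ a_m^{k_m}` (obtained from
the sorted sequence `a_1^{k_1} ⋯ a_m^{k_m}` by swapping the last `a_1` with
the first `a_2`) avoids the patterns `abba` and `abca`; consequently `p*`
avoids every pattern `σ` containing one of these, as well as the reverse of
every such `σ`. -/
theorem swapped_sorted_avoids {A : Type*} (m : ℕ) (hm : 2 ≤ m)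
    (a : Fin m → A) (ha : Function.Injective a)
    (k : Fin m → ℕ) (hk : ∀ i, 0 < k i) (hk0 : 2 ≤ k ⟨0, by omega⟩) :
    ¬ ContainsPat
        (List.replicate (k ⟨0, by omega⟩ - 1) (a ⟨0, by omega⟩)
          ++ [a ⟨1, by omega⟩] ++ [a ⟨0, by omega⟩]
          ++ List.replicate (k ⟨1, by omega⟩ - 1) (a ⟨1, by omega⟩)
          ++ ((List.ofFn fun i : Fin m => List.replicate (k i) (a i)).drop 2).flatten)
        ([0, 1, 1, 0] : List ℕ) ∧
    ¬ ContainsPat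
        (List.replicate (k ⟨0, by omega⟩ - 1) (a ⟨0, by omega⟩)
          ++ [a ⟨1, by omega⟩] ++ [a ⟨0, by omega⟩]
          ++ List.replicate (k ⟨1, by omega⟩ - 1) (a ⟨1, by omega⟩)
          ++ ((List.ofFn fun i : Fin m => List.replicate (k i) (a i)).drop 2).flatten)
        ([0, 1, 2, 0] : List ℕ) ∧
    ∀ {B : Type*} (σ : List B),
      (ContainsPat σ ([0, 1, 1, 0] : List ℕ) ∨
        ContainsPat σ ([0, 1, 2, 0] : List ℕ)) →
      ¬ ContainsPat
          (List.replicate (k ⟨0, by omega⟩ - 1) (a ⟨0, by omega⟩)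
            ++ [a ⟨1, by omega⟩] ++ [a ⟨0, by omega⟩]
            ++ List.replicate (k ⟨1, by omega⟩ - 1) (a ⟨1, by omega⟩)
            ++ ((List.ofFn fun i : Fin m => List.replicate (k i) (a i)).drop 2).flatten)
          σ ∧
      ¬ ContainsPat
          (List.replicate (k ⟨0, by omega⟩ - 1) (a ⟨0, by omega⟩)
            ++ [a ⟨1, by omega⟩] ++ [a ⟨0, by omega⟩]
            ++ List.replicate (k ⟨1, by omega⟩ - 1) (a ⟨1, by omega⟩)
            ++ ((List.ofFn fun i : Fin m => List.replicate (k i) (a i)).drop 2).flatten)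
          σ.reverse := by
  have hp := NoWideReturn.swapped_sorted ha k (i₀ := ⟨0, by omega⟩) (i₁ := ⟨1, by omega⟩) rfl rfl
    (k ⟨0, by omega⟩ - 1) (k ⟨1, by omega⟩ - 1)
  refine ⟨hp.not_containsPat_of_sublist (by decide) (by decide) (List.Sublist.refl _),
    hp.not_containsPat_of_sublist (by decide) (by decide) (List.Sublist.refl _),
    fun σ hσ => ?_⟩
  have hwide : ¬ NoWideReturn σ := by
    rintro h
    rcases hσ with hσ | hσ
    · exact h.not_containsPat_of_sublist (by decide) (by decide) (List.Sublist.refl _) hσ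
    · exact h.not_containsPat_of_sublist (by decide) (by decide) (List.Sublist.refl _) hσ
  exact ⟨fun h => hwide (hp.of_containsPat h),
    fun h => hwide (hp.of_containsPat h).of_reverse⟩
end
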